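/- arXiv:2001.08643 — 3 statements merged into one kernel-verified Lean document; each statement's English description precedes it below -/
import Mathlib

section
/- Let n, r be positive integers, let K ∈ ℂ^{n×n} be Hermitian, let k_min be the smallest eigenvalue of K, and set K_pos = K − k_min I_n. Let e_t > 0 and let U_j, U_{j+1} ∈ ℂ^{r×n} satisfy tr(U_j U_j^H) = tr(U_{j+1} U_{j+1}^H) = e_t and Re(tr(U_j K_pos U_{j+1}^H)) ≥ Re(tr(U_j K_pos U_j^H)). Then tr(U_{j+1} K U_{j+1}^H) ≥ tr(U_j K U_j^H). In particular, the iterates of the minorization–maximization step, in which U_{j+1} maximizes Re(tr(U_j K_pos U^H)) over matrices U with prescribed column norms (hence with tr(U U^H) = e_t), yield a monotonically nondecreasing sequence of objective values tr(U_j K U_j^H). -/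
open Matrix

open scoped ComplexOrder

/-- A Hermitian matrix minus a lower bound of its eigenvalues is positive semidefinite. -/
lemma Matrix.IsHermitian.posSemidef_sub_smul_one {n : Type*} [Fintype n] [DecidableEq n]
    {K : Matrix n n ℂ} (hK : K.IsHermitian) {c : ℝ} (hc : ∀ i, c ≤ hK.eigenvalues i) :
    (K - (c : ℂ) • (1 : Matrix n n ℂ)).PosSemidef := by
  have hH : (K - (c : ℂ) • (1 : Matrix n n ℂ)).IsHermitian := by
    refine hK.sub ?_
    simp [Matrix.IsHermitian, Matrix.conjTranspose_smul]
  refine Matrix.posSemidef_iff_isHermitian_and_spectrum_nonneg.2 ⟨hH, ?_⟩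
  intro z hz
  rw [← Algebra.algebraMap_eq_smul_one, ← spectrum.sub_singleton_eq,
    hK.spectrum_eq_image_range] at hz
  obtain ⟨_, ⟨_, ⟨i, rfl⟩, rfl⟩, _, rfl, rfl⟩ := hz
  simpa using hc i

/-- For positive semidefinite `P`, the form `U ↦ Re tr(U P Uᴴ)` lies above its linearizations. -/
lemma Matrix.PosSemidef.two_mul_re_trace_le {m n : Type*} [Fintype m] [Fintype n]
    {P : Matrix n n ℂ} (hP : P.PosSemidef) (U V : Matrix m n ℂ) :
    2 * (U * P * Vᴴ).trace.re ≤ (U * P * Uᴴ).trace.re + (V * P * Vᴴ).trace.re := by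
  have h0 : 0 ≤ ((V - U) * P * (V - U)ᴴ).trace.re :=
    (Complex.le_def.1 (hP.mul_mul_conjTranspose_same (V - U)).trace_nonneg).1
  have hsymm : (V * P * Uᴴ).trace.re = (U * P * Vᴴ).trace.re := by
    have h : (U * P * Vᴴ)ᴴ = V * P * Uᴴ := by
      simp [Matrix.conjTranspose_mul, hP.isHermitian.eq, Matrix.mul_assoc]
    rw [← h, Matrix.trace_conjTranspose]
    simp
  simp only [Matrix.conjTranspose_sub, Matrix.sub_mul, Matrix.mul_sub, Matrix.trace_sub,
    Complex.sub_re] at h0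
  linarith

/-- Appendix B, ascent property of the MM step: for Hermitian `K` with
smallest eigenvalue `k_min` and `K_pos = K − k_min I`, if `U_j, U_{j+1}` have
`tr(U_j U_jᴴ) = tr(U_{j+1} U_{j+1}ᴴ) = e_t` and
`Re(tr(U_j K_pos U_{j+1}ᴴ)) ≥ Re(tr(U_j K_pos U_jᴴ))`, then
`tr(U_{j+1} K U_{j+1}ᴴ) ≥ tr(U_j K U_jᴴ)`. -/
theorem stmt7 (n r : ℕ) (hn : 0 < n) (hr : 0 < r)
    (K : Matrix (Fin n) (Fin n) ℂ) (hK : K.IsHermitian)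
    (kmin : ℝ) (hkmin : IsLeast (Set.range hK.eigenvalues) kmin)
    (Kpos : Matrix (Fin n) (Fin n) ℂ)
    (hKpos : Kpos = K - (kmin : ℂ) • (1 : Matrix (Fin n) (Fin n) ℂ))
    (et : ℝ) (het : 0 < et)
    (Uj Uj1 : Matrix (Fin r) (Fin n) ℂ)
    (hUj : (Uj * Ujᴴ).trace = (et : ℂ)) (hUj1 : (Uj1 * Uj1ᴴ).trace = (et : ℂ))
    (hstep : (Uj * Kpos * Ujᴴ).trace.re ≤ (Uj * Kpos * Uj1ᴴ).trace.re) :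
    (Uj * K * Ujᴴ).trace.re ≤ (Uj1 * K * Uj1ᴴ).trace.re := by
  have hP : Kpos.PosSemidef :=
    hKpos ▸ hK.posSemidef_sub_smul_one fun i => hkmin.2 (Set.mem_range_self i)
  have hshift : ∀ U : Matrix (Fin r) (Fin n) ℂ, (U * Uᴴ).trace = (et : ℂ) →
      (U * Kpos * Uᴴ).trace.re = (U * K * Uᴴ).trace.re - kmin * et := by
    intro U hU
    simp [hKpos, Matrix.mul_sub, Matrix.sub_mul, hU]
  linarith [hP.two_mul_re_trace_le Uj Uj1, hshift Uj hUj, hshift Uj1 hUj1]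
end

section
/- Let M, L, N_T, N_R, r be positive integers and P a nonnegative integer. For each integer p with −P ≤ p ≤ P and each k in a finite index set K, let σ_{p,k}² ≥ 0, d_{p,k} ∈ ℂ^M, a_{T,p,k} ∈ ℂ^{N_T}, a_{R,p,k} ∈ ℂ^{N_R}, A_{p,k} = a_{R,p,k} a_{T,p,k}^T, and V_{k,p} = d_{p,k} ⊗ J_p^T ⊗ A_{p,k} ∈ ℂ^{L M N_R × L N_T}. Let R_Jn ∈ ℂ^{L M N_R × L M N_R} be Hermitian and let U_s ∈ ℂ^{r × L N_T}. For l = 1,…,r, let c_l ∈ ℂ^{L N_T} be the l-th column of U_s^H, let C_l ∈ ℂ^{N_T × L} satisfy vec(C_l) = c_l, set C_{p,l} = C_l J_p and C̃_{p,l} = I_M ⊗ C_{p,l}^T ⊗ I_{N_R}. Define ṽ_{p,k} = d_{p,k} ⊗ a_{T,p,k} ⊗ a_{R,p,k} and R̃_{c,p} = Σ_{k∈K} σ_{p,k}² ṽ_{p,k} ṽ_{p,k}^H. Then Σ_{p=−P}^{P} Σ_{k∈K} σ_{p,k}² V_{k,p} U_s^H U_s V_{k,p}^H + R_Jn = Σ_{p=−P}^{P}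 Σ_{l=1}^{r} C̃_{p,l} R̃_{c,p} C̃_{p,l}^H + R_Jn. -/
open Matrix
open scoped Kronecker

/-- The `L × L` shift matrix `J_p`, with `J_p(i,j) = 1` iff `i - j + p = 0`. -/
noncomputable def shiftJ (L : ℕ) (p : ℤ) : Matrix (Fin L) (Fin L) ℂ :=
  fun i j => if ((i : ℤ) - (j : ℤ) + p = 0) then 1 else 0

/-- Kronecker product of two (column) vectors. -/
def vkron {m n : Type*} (u : m → ℂ) (v : n → ℂ) : m × n → ℂ :=
  fun q => u q.1 * v q.2

/-- A Kronecker product of matrices acts factorwise on a Kronecker product of vectors. -/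
theorem kronecker_mulVec_vkron {m m' n n' : Type*} [Fintype m'] [Fintype n']
    (A : Matrix m m' ℂ) (B : Matrix n n' ℂ) (u : m' → ℂ) (v : n' → ℂ) :
    (A ⊗ₖ B) *ᵥ vkron u v = vkron (A *ᵥ u) (B *ᵥ v) := by
  ext i
  simp only [mulVec, dotProduct, vkron, kroneckerMap_apply, Fintype.sum_prod_type,
    Finset.sum_mul_sum]
  exact Finset.sum_congr rfl fun _ _ => Finset.sum_congr rfl fun _ _ => by ring

/-- The outer product expansion of `X * Xᴴ` over the columns of `X`. -/
theorem mul_conjTranspose_eq_sum_vecMulVec {m n : Type*} [Fintype n] (X : Matrix m n ℂ) :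
    X * Xᴴ = ∑ l, vecMulVec (X.col l) (star (X.col l)) := by
  ext i j
  simp [mul_apply, Matrix.sum_apply, vecMulVec_apply]

/-- Conjugating the outer product of a vector with itself by a matrix. -/
theorem mul_vecMulVec_star_mul_conjTranspose {m n : Type*} [Fintype n]
    (B : Matrix m n ℂ) (v : n → ℂ) :
    B * vecMulVec v (star v) * Bᴴ = vecMulVec (B *ᵥ v) (star (B *ᵥ v)) := by
  rw [mul_vecMulVec, vecMulVec_mul, star_mulVec]

/-- eq. (44): the alternative expression of `R_u(U_s)`:
`Σ_p Σ_k σ_{p,k}² V_{k,p} U_sᴴ U_s V_{k,p}ᴴ + R_Jn = Σ_p Σ_l C̃_{p,l} R̃_{c,p} C̃_{p,l}ᴴ + R_Jn`,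
where `V_{k,p} = d_{p,k} ⊗ J_pᵀ ⊗ A_{p,k}` with `A_{p,k} = a_{R,p,k} a_{T,p,k}ᵀ`,
`c_l` are the columns of `U_sᴴ`, `vec(C_l) = c_l`, `C̃_{p,l} = I_M ⊗ (C_l J_p)ᵀ ⊗ I_{N_R}`,
`ṽ_{p,k} = d_{p,k} ⊗ a_{T,p,k} ⊗ a_{R,p,k}`, and `R̃_{c,p} = Σ_k σ_{p,k}² ṽ_{p,k} ṽ_{p,k}ᴴ`. -/
theorem stmt13 (M L nT nR r : ℕ) (hM : 0 < M) (hL : 0 < L) (hT : 0 < nT) (hR : 0 < nR)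
    (hr : 0 < r) (P : ℕ)
    (K : Type*) [Fintype K]
    (σsq : ℤ → K → ℝ) (hσ : ∀ p k, 0 ≤ σsq p k)
    (d : ℤ → K → Fin M → ℂ) (aT : ℤ → K → Fin nT → ℂ) (aR : ℤ → K → Fin nR → ℂ)
    (A : ℤ → K → Matrix (Fin nR) (Fin nT) ℂ)
    (hA : ∀ p k, A p k = Matrix.vecMulVec (aR p k) (aT p k))
    -- `V_{k,p} = d_{p,k} ⊗ J_pᵀ ⊗ A_{p,k}` (with `d_{p,k}` a column vector)
    (V : ℤ → K → Matrix (Fin M × Fin L × Fin nR) (Fin L × Fin nT) ℂ)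
    (hV : ∀ p k, V p k = Matrix.of fun i j =>
      d p k i.1 * (shiftJ L p)ᵀ i.2.1 j.1 * A p k i.2.2 j.2)
    (RJn : Matrix (Fin M × Fin L × Fin nR) (Fin M × Fin L × Fin nR) ℂ) (hRJn : RJn.IsHermitian)
    (Us : Matrix (Fin r) (Fin L × Fin nT) ℂ)
    -- `C_l` is the matrix with `vec(C_l) = c_l`, `c_l` the `l`-th column of `U_sᴴ`
    (C : Fin r → Matrix (Fin nT) (Fin L) ℂ)
    (hC : ∀ (l : Fin r) (q : Fin L × Fin nT), C l q.2 q.1 = Usᴴ q l)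
    -- `C̃_{p,l} = I_M ⊗ C_{p,l}ᵀ ⊗ I_{N_R}` with `C_{p,l} = C_l J_p`
    (Ctil : ℤ → Fin r → Matrix (Fin M × Fin L × Fin nR) (Fin M × Fin nT × Fin nR) ℂ)
    (hCtil : ∀ p l, Ctil p l = (1 : Matrix (Fin M) (Fin M) ℂ) ⊗ₖ
      ((C l * shiftJ L p)ᵀ ⊗ₖ (1 : Matrix (Fin nR) (Fin nR) ℂ)))
    -- `ṽ_{p,k} = d_{p,k} ⊗ a_{T,p,k} ⊗ a_{R,p,k}`
    (vtil : ℤ → K → (Fin M × Fin nT × Fin nR → ℂ))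
    (hvtil : ∀ p k, vtil p k = vkron (d p k) (vkron (aT p k) (aR p k)))
    -- `R̃_{c,p} = Σ_k σ_{p,k}² ṽ_{p,k} ṽ_{p,k}ᴴ`
    (Rtil : ℤ → Matrix (Fin M × Fin nT × Fin nR) (Fin M × Fin nT × Fin nR) ℂ)
    (hRtil : ∀ p, Rtil p = ∑ k : K,
      (σsq p k : ℂ) • Matrix.vecMulVec (vtil p k) (star (vtil p k))) :
    ∑ p ∈ Finset.Icc (-(P : ℤ)) (P : ℤ), ∑ k : K,
        (σsq p k : ℂ) • (V p k * Usᴴ * Us * (V p k)ᴴ) + RJn =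
      ∑ p ∈ Finset.Icc (-(P : ℤ)) (P : ℤ), ∑ l : Fin r,
        Ctil p l * Rtil p * (Ctil p l)ᴴ + RJn := by
  have hcol : ∀ p k l, (V p k * Usᴴ).col l = Ctil p l *ᵥ vtil p k := by
    intro p k l
    rw [hCtil, hvtil, kronecker_mulVec_vkron, kronecker_mulVec_vkron, one_mulVec, one_mulVec]
    ext ⟨m, i, n⟩
    simp only [col_apply, mul_apply, hV, hA, of_apply, transpose_apply, vecMulVec_apply,
      vkron, mulVec, dotProduct, Fintype.sum_prod_type, ← hC, Finset.sum_mul, Finset.mul_sum]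
    rw [Finset.sum_comm]
    exact Finset.sum_congr rfl fun _ _ => Finset.sum_congr rfl fun _ _ => by ring
  congr 1
  refine Finset.sum_congr rfl fun p _ => ?_
  have hterm : ∀ k, V p k * Usᴴ * Us * (V p k)ᴴ =
      ∑ l, Ctil p l * vecMulVec (vtil p k) (star (vtil p k)) * (Ctil p l)ᴴ := by
    intro k
    have hXX : V p k * Usᴴ * Us * (V p k)ᴴ = (V p k * Usᴴ) * (V p k * Usᴴ)ᴴ := by
      rw [conjTranspose_mul, conjTranspose_conjTranspose, Matrix.mul_assoc (V p k * Usᴴ)]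
    simp only [hXX, mul_conjTranspose_eq_sum_vecMulVec, hcol,
      mul_vecMulVec_star_mul_conjTranspose]
  simp only [hterm, hRtil, Finset.smul_sum, Matrix.mul_sum, Matrix.sum_mul, Matrix.mul_smul,
    Matrix.smul_mul]
  exact Finset.sum_comm
end

section
/- Let M, L, N_T, N_R be positive integers, P a nonnegative integer, β ∈ ℝ, and w ∈ ℂ^{L M N_R}. For each integer p with −P ≤ p ≤ P and each k in a finite index set K, let σ_{p,k}² ≥ 0, d_{p,k} ∈ ℂ^M, a_{T,p,k} ∈ ℂ^{N_T}, a_{R,p,k} ∈ ℂ^{N_R}, A_{p,k} = a_{R,p,k} a_{T,p,k}^T, and V_{k,p} = d_{p,k} ⊗ J_p^T ⊗ A_{p,k} ∈ ℂ^{L M N_R × L N_T}. Let K_c ∈ ℂ^{L N_R × L N_R} be the commutation matrix and let Ŵ ∈ ℂ^{L × M N_R} satisfy vec(Ŵ) = (I_M ⊗ K_c) w; set W̃_p = (J_p Ŵ) ⊗ I_{N_T}, v̆_{k,p} = d_{p,k} ⊗ a_{R,p,k} ⊗ a_{T,p,k}, and R̆_{c,p} = Σ_{k∈K} σ_{p,k}²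 conj(v̆_{k,p}) v̆_{k,p}^T. Then Σ_{p=−P}^{P} Σ_{k∈K} σ_{p,k}² V_{k,p}^H w w^H V_{k,p} + β I_{L N_T} = Σ_{p=−P}^{P} W̃_p R̆_{c,p} W̃_p^H + β I_{L N_T}. -/
open Matrix
open scoped Kronecker

/-- The `L N_R × L N_R` commutation matrix `K_c`: it satisfies `K_c vec(M) = vec(Mᵀ)` for
every `M ∈ ℂ^{N_R × L}`, where `vec` stacks columns (so `vec(M)` is indexed by
`Fin L × Fin nR` and `vec(Mᵀ)` by `Fin nR × Fin L`). -/
def commK (L nR : ℕ) : Matrix (Fin nR × Fin L) (Fin L × Fin nR) ℂ :=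
  fun q q' => if q'.1 = q.2 ∧ q'.2 = q.1 then 1 else 0

theorem one_kronecker_commK_mulVec {M L nR : ℕ} (w : Fin M × Fin L × Fin nR → ℂ)
    (m : Fin M) (r : Fin nR) (l : Fin L) :
    (((1 : Matrix (Fin M) (Fin M) ℂ) ⊗ₖ commK L nR).mulVec w) (m, (r, l)) = w (m, (l, r)) := by
  rw [mulVec, dotProduct, Finset.sum_eq_single (m, (l, r))]
  · simp [commK]
  · rintro ⟨m', l', r'⟩ - h
    by_cases hm : m = m' <;> simp_all [commK]
  · simp

theorem kronecker_one_mulVec_star_vkron {l m n : Type*} [Fintype m] [Fintype n] [DecidableEq n]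
    (B : Matrix l m ℂ) (u : m → ℂ) (v : n → ℂ) (i : l) (j : n) :
    ((B ⊗ₖ (1 : Matrix n n ℂ)) *ᵥ star (vkron u v)) (i, j) = (B *ᵥ star u) i * star (v j) := by
  simp [mulVec, dotProduct, Fintype.sum_prod_type, vkron, Matrix.one_apply, Finset.sum_mul,
    mul_assoc]

theorem conjTranspose_mul_vecMulVec_star_mul {m n : Type*} [Fintype m]
    (B : Matrix m n ℂ) (w : m → ℂ) :
    Bᴴ * vecMulVec w (star w) * B = vecMulVec (Bᴴ *ᵥ w) (star (Bᴴ *ᵥ w)) := by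
  rw [mul_vecMulVec, vecMulVec_mul, star_mulVec, conjTranspose_conjTranspose]

/-- eq. (46): the alternative expression of `R_u(w)`:
`Σ_p Σ_k σ_{p,k}² V_{k,p}ᴴ w wᴴ V_{k,p} + β I = Σ_p W̃_p R̆_{c,p} W̃_pᴴ + β I`,
where `V_{k,p} = d_{p,k} ⊗ J_pᵀ ⊗ A_{p,k}` with `A_{p,k} = a_{R,p,k} a_{T,p,k}ᵀ`,
`vec(Ŵ) = (I_M ⊗ K_c) w` with `K_c` the commutation matrix, `W̃_p = (J_p Ŵ) ⊗ I_{N_T}`,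
`v̆_{k,p} = d_{p,k} ⊗ a_{R,p,k} ⊗ a_{T,p,k}`, and
`R̆_{c,p} = Σ_k σ_{p,k}² conj(v̆_{k,p}) v̆_{k,p}ᵀ`. -/
theorem stmt14 (M L nT nR : ℕ) (hM : 0 < M) (hL : 0 < L) (hT : 0 < nT) (hR : 0 < nR)
    (P : ℕ) (β : ℝ) (w : Fin M × Fin L × Fin nR → ℂ)
    (K : Type*) [Fintype K]
    (σsq : ℤ → K → ℝ) (hσ : ∀ p k, 0 ≤ σsq p k)
    (d : ℤ → K → Fin M → ℂ) (aT : ℤ → K → Fin nT → ℂ) (aR : ℤ → K → Fin nR → ℂ)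
    (A : ℤ → K → Matrix (Fin nR) (Fin nT) ℂ)
    (hA : ∀ p k, A p k = Matrix.vecMulVec (aR p k) (aT p k))
    -- `V_{k,p} = d_{p,k} ⊗ J_pᵀ ⊗ A_{p,k}` (with `d_{p,k}` a column vector)
    (V : ℤ → K → Matrix (Fin M × Fin L × Fin nR) (Fin L × Fin nT) ℂ)
    (hV : ∀ p k, V p k = Matrix.of fun i j =>
      d p k i.1 * (shiftJ L p)ᵀ i.2.1 j.1 * A p k i.2.2 j.2)
    -- `Ŵ` satisfies `vec(Ŵ) = (I_M ⊗ K_c) w`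
    (What : Matrix (Fin L) (Fin M × Fin nR) ℂ)
    (hW : ∀ (m : Fin M) (rr : Fin nR) (l : Fin L),
      What l (m, rr) =
        (((1 : Matrix (Fin M) (Fin M) ℂ) ⊗ₖ commK L nR).mulVec w) (m, (rr, l)))
    -- `W̃_p = (J_p Ŵ) ⊗ I_{N_T}`
    (Wtil : ℤ → Matrix (Fin L × Fin nT) ((Fin M × Fin nR) × Fin nT) ℂ)
    (hWtil : ∀ p, Wtil p = (shiftJ L p * What) ⊗ₖ (1 : Matrix (Fin nT) (Fin nT) ℂ))
    -- `v̆_{k,p} = d_{p,k} ⊗ a_{R,p,k} ⊗ a_{T,p,k}`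
    (vbr : ℤ → K → ((Fin M × Fin nR) × Fin nT → ℂ))
    (hvbr : ∀ p k, vbr p k = vkron (vkron (d p k) (aR p k)) (aT p k))
    -- `R̆_{c,p} = Σ_k σ_{p,k}² conj(v̆_{k,p}) v̆_{k,p}ᵀ`
    (Rbr : ℤ → Matrix ((Fin M × Fin nR) × Fin nT) ((Fin M × Fin nR) × Fin nT) ℂ)
    (hRbr : ∀ p, Rbr p = ∑ k : K,
      (σsq p k : ℂ) • Matrix.vecMulVec (star (vbr p k)) (vbr p k)) :
    ∑ p ∈ Finset.Icc (-(P : ℤ)) (P : ℤ), ∑ k : K,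
        (σsq p k : ℂ) • ((V p k)ᴴ * Matrix.vecMulVec w (star w) * V p k) +
        (β : ℂ) • (1 : Matrix (Fin L × Fin nT) (Fin L × Fin nT) ℂ) =
      ∑ p ∈ Finset.Icc (-(P : ℤ)) (P : ℤ), Wtil p * Rbr p * (Wtil p)ᴴ +
        (β : ℂ) • (1 : Matrix (Fin L × Fin nT) (Fin L × Fin nT) ℂ) := by
  have key : ∀ p k, (V p k)ᴴ *ᵥ w = Wtil p *ᵥ star (vbr p k) := by
    intro p k
    ext ⟨l, t⟩
    have hJ : ∀ i j, star (shiftJ L p i j) = shiftJ L p i j := by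
      intro i j
      unfold shiftJ
      split_ifs <;> simp
    have hWw : ∀ m r l', What l' (m, r) = w (m, (l', r)) := fun m r l' => by
      rw [hW, one_kronecker_commK_mulVec]
    rw [hWtil, hvbr, kronecker_one_mulVec_star_vkron]
    simp only [mulVec, dotProduct, Matrix.mul_apply, hWw,
      Fintype.sum_prod_type, hV, hA, conjTranspose_apply, of_apply, transpose_apply,
      vecMulVec_apply, vkron, Pi.star_apply, star_mul', hJ, Finset.sum_mul]
    refine Finset.sum_congr rfl fun m _ => ?_
    rw [Finset.sum_comm]
    refine Finset.sum_congr rfl fun r _ => Finset.sum_congr rfl fun l' _ => ?_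
    ring
  congr 1
  refine Finset.sum_congr rfl fun p _ => ?_
  rw [hRbr, Matrix.mul_sum, Matrix.sum_mul]
  refine Finset.sum_congr rfl fun k _ => ?_
  rw [conjTranspose_mul_vecMulVec_star_mul, key, Matrix.mul_smul, Matrix.smul_mul,
    mul_vecMulVec, vecMulVec_mul, star_mulVec, star_star]
end
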